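/- Let N ≥ 2, let L be a positive definite Jacobi index of rank N, and let Λ ⊆ ℤ^N be a subgroup of finite index. There exists a finite set S ⊂ ℤ^N, depending only on L and Λ, such that for every τ ∈ ℍ and every holomorphic function f : ℂ^N → ℂ satisfying f(z + λτ + μ) = e(−τ·λᵀLλ/2 − λᵀLz)·f(z) for all λ, μ ∈ Λ and all z ∈ ℂ^N, the following holds: if for every s ∈ S the one-variable function ℂ → ℂ, w ↦ f(w·s), vanishes identically, then f vanishes identically on ℂ^N. -/

import Mathlib

open Matrix Complex

noncomputable section

/-- `e(x) = exp(2πi·x)`. -/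
def eC (x : ℂ) : ℂ := Complex.exp (2 * Real.pi * Complex.I * x)

/-- The casting `ℤ^N → ℂ^N`. -/
def zc {N : ℕ} (lam : Fin N → ℤ) : Fin N → ℂ := fun i => (lam i : ℂ)

open Filter Topology

/-- If the entire function `p` is not identically zero and at every point its order is at most the
order of `g`, then `p` divides `g` among entire functions. -/
theorem exists_differentiable_eq_mul {p g : ℂ → ℂ} (hp : Differentiable ℂ p)
    (hg : Differentiable ℂ g) (hp0 : p ≠ 0)
    (hord : ∀ z, analyticOrderAt p z ≤ analyticOrderAt g z) :
    ∃ h : ℂ → ℂ, Differentiable ℂ h ∧ ∀ z, g z = p z * h z := by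
  have hpt : ∀ z, analyticOrderAt p z ≠ ⊤ := fun z h =>
    hp0 ((AnalyticOnNhd.analyticOrderAt_eq_top_iff_eq_zero z fun w => hp.analyticAt w).1 h)
  have hmer : MeromorphicOn (g / p) Set.univ := fun z _ =>
    (hg.analyticAt z).meromorphicAt.div (hp.analyticAt z).meromorphicAt
  have han : ∀ z, AnalyticAt ℂ (toMeromorphicNFOn (g / p) Set.univ) z := by
    intro z
    rw [← (meromorphicNFOn_toMeromorphicNFOn (g / p) Set.univ
      (Set.mem_univ z)).meromorphicOrderAt_nonneg_iff_analyticAt,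
      meromorphicOrderAt_toMeromorphicNFOn hmer (Set.mem_univ z),
      meromorphicOrderAt_div (hg.analyticAt z).meromorphicAt (hp.analyticAt z).meromorphicAt,
      (hg.analyticAt z).meromorphicOrderAt_eq, (hp.analyticAt z).meromorphicOrderAt_eq]
    have h1 := hord z
    have h2 := hpt z
    lift analyticOrderAt p z to ℕ using h2 with a
    generalize analyticOrderAt g z = b at h1
    induction b using ENat.recTopCoe with
    | top => simp
    | coe b =>
      have : a ≤ b := by exact_mod_cast h1
      simp only [ENat.map_natCast]
      have h3 : ((b : ℤ) - (a : ℤ) : ℤ) = ((b - a : ℕ) : ℤ) := by omega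
      rw [← WithTop.LinearOrderedAddCommGroup.coe_sub, h3]
      exact_mod_cast Nat.zero_le _
  refine ⟨toMeromorphicNFOn (g / p) Set.univ, fun z => (han z).differentiableAt, fun z => ?_⟩
  have hne : ∀ᶠ w in 𝓝[≠] z, p w ≠ 0 := by
    rcases (hp.analyticAt z).eventually_eq_zero_or_eventually_ne_zero with h | h
    · exact absurd (analyticOrderAt_eq_top.2 h) (hpt z)
    · exact h
  have heq : ∀ᶠ w in 𝓝[≠] z, g w = p w * toMeromorphicNFOn (g / p) Set.univ w := by
    filter_upwards [hne, hmer.toMeromorphicNFOn_eq_self_on_nhdsNE (Set.mem_univ z)] with w h1 h2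
    rw [h2, Pi.div_apply, mul_div_cancel₀ _ h1]
  have hc1 : Tendsto g (𝓝[≠] z) (𝓝 (g z)) := hg.continuous.continuousAt.mono_left inf_le_left
  have hc2 : Tendsto (fun w => p w * toMeromorphicNFOn (g / p) Set.univ w) (𝓝[≠] z)
      (𝓝 (p z * toMeromorphicNFOn (g / p) Set.univ z)) :=
    ((hp.continuous.continuousAt).mul (han z).continuousAt).mono_left inf_le_left
  exact tendsto_nhds_unique hc1 (hc2.congr' (heq.mono fun _ h => h.symm))

/-- A continuous function of period `1` is bounded on horizontal strips. -/
theorem exists_bound_strip_of_periodic {H : ℂ → ℂ} (hH : Continuous H)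
    (hper : ∀ u, H (u + 1) = H u) (a b : ℝ) :
    ∃ C, 0 ≤ C ∧ ∀ z : ℂ, a ≤ z.im → z.im ≤ b → ‖H z‖ ≤ C := by
  have hK : IsCompact (Set.Icc (0 : ℝ) 1 ×ℂ Set.Icc a b) := isCompact_Icc.reProdIm isCompact_Icc
  obtain ⟨C, hC⟩ := hK.exists_bound_of_continuousOn hH.continuousOn
  refine ⟨max C 0, le_max_right _ _, fun z h1 h2 => ?_⟩
  have hp : Function.Periodic H 1 := hper
  have h3 : H (z - ⌊z.re⌋) = H z := by simpa using hp.sub_int_mul_eq (x := z) ⌊z.re⌋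
  rw [← h3]
  refine (hC _ ?_).trans (le_max_left _ _)
  rw [mem_reProdIm]
  simp only [sub_re, intCast_re, sub_im, intCast_im, sub_zero, Set.mem_Icc]
  refine ⟨⟨?_, ?_⟩, h1, h2⟩
  · linarith [Int.floor_le z.re]
  · linarith [Int.lt_floor_add_one z.re]

/-- Maximum principle for entire functions of period `1` on a horizontal strip. -/
theorem norm_le_of_periodic_of_im_eq {H : ℂ → ℂ} (hH : Differentiable ℂ H)
    (hper : ∀ u, H (u + 1) = H u) {a b C : ℝ} (hab : a < b)
    (ha : ∀ z : ℂ, z.im = a → ‖H z‖ ≤ C) (hb : ∀ z : ℂ, z.im = b → ‖H z‖ ≤ C) {z : ℂ}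
    (hza : a ≤ z.im) (hzb : z.im ≤ b) : ‖H z‖ ≤ C := by
  obtain ⟨M, hM0, hM⟩ := exists_bound_strip_of_periodic hH.continuous hper a b
  refine PhragmenLindelof.horizontal_strip hH.diffContOnCl ⟨0, ?_, 0, ?_⟩ ha hb hza hzb
  · exact div_pos Real.pi_pos (sub_pos.2 hab)
  · refine Asymptotics.IsBigO.of_bound M ?_
    refine eventually_inf_principal.2 (Eventually.of_forall fun w hw => ?_)
    simpa using hM w hw.1.le hw.2.le

theorem norm_cos_le_exp (z : ℂ) : ‖Complex.cos z‖ ≤ Real.exp |z.im| := by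
  rw [Complex.cos, norm_div]
  have h1 : ‖Complex.exp (z * I) + Complex.exp (-z * I)‖ ≤ Real.exp |z.im| + Real.exp |z.im| := by
    refine (norm_add_le _ _).trans (add_le_add ?_ ?_) <;> rw [Complex.norm_exp] <;> simp
    · exact neg_le_abs _
    · exact le_abs_self _
  simp only [Complex.norm_ofNat]
  linarith

theorem sinh_abs_im_le_norm_cos (z : ℂ) : Real.sinh |z.im| ≤ ‖Complex.cos z‖ := by
  rw [Complex.cos, norm_div, Real.sinh_eq]
  have h1 : ‖Complex.exp (z * I)‖ = Real.exp (-z.im) := by rw [Complex.norm_exp]; simp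
  have h2 : ‖Complex.exp (-z * I)‖ = Real.exp z.im := by rw [Complex.norm_exp]; simp
  have h3 := norm_sub_le_norm_add (Complex.exp (z * I)) (Complex.exp (-z * I))
  have h4 := norm_sub_le_norm_add (Complex.exp (-z * I)) (Complex.exp (z * I))
  rw [add_comm (Complex.exp (-z * I))] at h4
  rw [h1, h2] at h3 h4
  simp only [Complex.norm_ofNat]
  rcases abs_cases z.im with ⟨h, _⟩ | ⟨h, _⟩ <;> rw [h]
  · linarith
  · rw [neg_neg]
    linarith

theorem norm_eC (x : ℂ) : ‖eC x‖ = Real.exp (-(2 * Real.pi * x.im)) := by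
  rw [eC, Complex.norm_exp]
  simp

theorem eC_ne_zero (x : ℂ) : eC x ≠ 0 := Complex.exp_ne_zero _

theorem eC_add (x y : ℂ) : eC (x + y) = eC x * eC y := by
  rw [eC, eC, eC, ← Complex.exp_add]
  ring_nf

theorem differentiable_eC : Differentiable ℂ eC := by
  unfold eC
  fun_prop

theorem analyticOrderAt_add_eq_of_quasiperiodic {g E : ℂ → ℂ} (hg : Differentiable ℂ g)
    (hE : Differentiable ℂ E) (hE0 : ∀ u, E u ≠ 0) {a : ℂ} (h : ∀ u, g (u + a) = E u * g u)
    (z : ℂ) : analyticOrderAt g (z + a) = analyticOrderAt g z := by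
  have h1 : analyticOrderAt (g ∘ fun u => u + a) z = analyticOrderAt g (z + a) :=
    analyticOrderAt_comp_of_deriv_ne_zero (by fun_prop) (by simp)
  have h2 : (g ∘ fun u => u + a) = E * g := funext h
  rw [← h1, h2, analyticOrderAt_mul (hE.analyticAt z) (hg.analyticAt z),
    ((hE.analyticAt z).analyticOrderAt_eq_zero).2 (hE0 z), zero_add]

theorem quasiperiodic_int_mul {g : ℂ → ℂ} {τ c K : ℂ}
    (h : ∀ u, g (u + τ) = eC (c - K * u - K * τ / 2) * g u) (n : ℤ) (u : ℂ) :
    g (u + n * τ) = eC (n * c - n * K * u - K * τ * n ^ 2 / 2) * g u := by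
  induction n using Int.induction_on with
  | zero => simp [eC]
  | succ n ih =>
    have e : u + ((n + 1 : ℤ) : ℂ) * τ = u + ((n : ℤ) : ℂ) * τ + τ := by push_cast; ring
    rw [e, h, ih, ← mul_assoc, ← eC_add]
    congr 2
    push_cast
    ring
  | pred n ih =>
    have e : u + ((-n : ℤ) : ℂ) * τ = u + ((-n - 1 : ℤ) : ℂ) * τ + τ := by push_cast; ring
    rw [e, h] at ih
    apply mul_left_cancel₀ (eC_ne_zero (c - K * (u + ((-n - 1 : ℤ) : ℂ) * τ) - K * τ / 2))
    rw [ih, ← mul_assoc, ← eC_add]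
    congr 2
    push_cast
    ring

/-- An entire function with simple zeros at the points of `ℤ ± (j + 1) τ`. -/
def rowFactor (τ : ℂ) (j : ℕ) (u : ℂ) : ℂ :=
  Complex.cos (2 * Real.pi * u) - Complex.cos (2 * Real.pi * ((j + 1) * τ))

theorem differentiable_rowFactor (τ : ℂ) (j : ℕ) : Differentiable ℂ (rowFactor τ j) := by
  unfold rowFactor
  fun_prop

theorem exists_eq_add_mul_of_rowFactor_eq_zero {τ : ℂ} {j : ℕ} {z : ℂ}
    (h : rowFactor τ j z = 0) : ∃ a l : ℤ, z = a + l * τ ∧ |l| = j + 1 := by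
  have hpi : (Real.pi : ℂ) ≠ 0 := by exact_mod_cast Real.pi_ne_zero
  rw [rowFactor, sub_eq_zero, Complex.cos_eq_cos_iff] at h
  obtain ⟨k, h | h⟩ := h
  · refine ⟨-k, j + 1, ?_, abs_of_nonneg (by positivity)⟩
    push_cast
    have : (2 * Real.pi : ℂ) * ((j + 1) * τ) = 2 * Real.pi * (k + z) := by rw [h]; ring
    have := mul_left_cancel₀ (by simp [hpi]) this
    rw [this]
    ring
  · refine ⟨k, -(j + 1), ?_, by rw [abs_neg]; exact abs_of_nonneg (by positivity)⟩
    push_cast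
    have : (2 * Real.pi : ℂ) * ((j + 1) * τ) = 2 * Real.pi * (k - z) := by rw [h]; ring
    have := mul_left_cancel₀ (by simp [hpi]) this
    rw [neg_mul, this]
    ring

theorem abs_im_of_rowFactor_eq_zero {τ : ℂ} (hτ : 0 < τ.im) {j : ℕ} {z : ℂ}
    (h : rowFactor τ j z = 0) : |z.im| = (j + 1) * τ.im := by
  obtain ⟨a, l, rfl, hl⟩ := exists_eq_add_mul_of_rowFactor_eq_zero h
  have : |(l : ℝ)| = j + 1 := by exact_mod_cast congrArg (Int.cast : ℤ → ℝ) hl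
  simp [abs_mul, this, abs_of_pos hτ]

theorem analyticOrderAt_rowFactor {τ : ℂ} (hτ : 0 < τ.im) {j : ℕ} {z : ℂ}
    (h : rowFactor τ j z = 0) : analyticOrderAt (rowFactor τ j) z = 1 := by
  refine ((differentiable_rowFactor τ j).analyticAt z).analyticOrderAt_eq_one_of_zero_deriv_ne_zero
    h ?_
  have hd : HasDerivAt (rowFactor τ j) (-Complex.sin (2 * Real.pi * z) * (2 * Real.pi)) z := by
    unfold rowFactor
    have := ((hasDerivAt_id z).const_mul (2 * Real.pi : ℂ)).ccos.sub_const
      (Complex.cos (2 * Real.pi * ((j + 1) * τ)))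
    simpa using this
  have hpi : (Real.pi : ℂ) ≠ 0 := by exact_mod_cast Real.pi_ne_zero
  rw [hd.deriv]
  refine mul_ne_zero (neg_ne_zero.2 fun hs => ?_) (by simp [hpi])
  obtain ⟨k, hk⟩ := Complex.sin_eq_zero_iff.1 hs
  have h2 : z * 2 = k := mul_left_cancel₀ hpi (by rw [mul_comm (Real.pi : ℂ) k, ← hk]; ring)
  have h3 : z.im = 0 := by simpa using congrArg Complex.im h2
  have h4 := abs_im_of_rowFactor_eq_zero hτ h
  rw [h3, abs_zero] at h4
  have : 0 < (j + 1) * τ.im := by positivity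
  linarith

theorem norm_rowFactor_le {τ : ℂ} (hτ : 0 < τ.im) {n j : ℕ} (hj : j < n) (u : ℂ) :
    ‖rowFactor τ j u‖ ≤
      (1 + Real.exp (2 * Real.pi * |u.im|)) * Real.exp (2 * Real.pi * (n * τ.im)) := by
  have h1 := norm_cos_le_exp (2 * Real.pi * u)
  have h2 := norm_cos_le_exp (2 * Real.pi * ((j + 1) * τ))
  have i1 : (2 * Real.pi * u : ℂ).im = 2 * Real.pi * u.im := by simp
  have i2 : (2 * Real.pi * ((j + 1) * τ) : ℂ).im = 2 * Real.pi * ((j + 1) * τ.im) := by simp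
  rw [i1, abs_mul, abs_of_pos Real.two_pi_pos] at h1
  rw [i2, abs_of_pos (by have := Real.pi_pos; positivity)] at h2
  have h3 : Real.exp (2 * Real.pi * ((j + 1) * τ.im)) ≤ Real.exp (2 * Real.pi * (n * τ.im)) := by
    have : (j + 1 : ℝ) ≤ n := by exact_mod_cast hj
    have := Real.pi_pos
    gcongr
  have h4 : 1 ≤ Real.exp (2 * Real.pi * (n * τ.im)) :=
    Real.one_le_exp (by have := Real.pi_pos; positivity)
  have h5 := Real.exp_pos (2 * Real.pi * |u.im|)
  have h6 := norm_sub_le (Complex.cos (2 * Real.pi * u)) (Complex.cos (2 * Real.pi * ((j + 1) * τ)))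
  rw [rowFactor]
  nlinarith

theorem le_norm_rowFactor {τ : ℂ} (hτ : 0 < τ.im) {n j : ℕ} (hj : j < n) {u : ℂ}
    (hu : |u.im| = 2 * n * τ.im) (hn : 5 ≤ Real.exp (2 * Real.pi * (n * τ.im))) :
    Real.exp (2 * Real.pi * (n * τ.im)) ^ 2 / 4 ≤ ‖rowFactor τ j u‖ := by
  have h1 := sinh_abs_im_le_norm_cos (2 * Real.pi * u)
  have h2 := norm_cos_le_exp (2 * Real.pi * ((j + 1) * τ))
  have i1 : (2 * Real.pi * u : ℂ).im = 2 * Real.pi * u.im := by simp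
  have i2 : (2 * Real.pi * ((j + 1) * τ) : ℂ).im = 2 * Real.pi * ((j + 1) * τ.im) := by simp
  rw [i1, abs_mul, abs_of_pos Real.two_pi_pos, hu, Real.sinh_eq] at h1
  rw [i2, abs_of_pos (by have := Real.pi_pos; positivity)] at h2
  have h3 : Real.exp (2 * Real.pi * ((j + 1) * τ.im)) ≤ Real.exp (2 * Real.pi * (n * τ.im)) := by
    have : (j + 1 : ℝ) ≤ n := by exact_mod_cast hj
    have := Real.pi_pos
    gcongr
  have h4 : Real.exp (2 * Real.pi * (2 * n * τ.im)) = Real.exp (2 * Real.pi * (n * τ.im)) ^ 2 := by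
    rw [← Real.exp_nat_mul]
    push_cast
    ring_nf
  have h5 : Real.exp (-(2 * Real.pi * (2 * n * τ.im))) ≤ 1 :=
    Real.exp_le_one_iff.2 (by have := Real.pi_pos; simp only [Left.neg_nonpos_iff]; positivity)
  have h6 := norm_sub_norm_le (Complex.cos (2 * Real.pi * u))
    (Complex.cos (2 * Real.pi * ((j + 1) * τ)))
  rw [h4] at h1
  rw [rowFactor]
  nlinarith

theorem rowFactor_add_one (τ : ℂ) (j : ℕ) (u : ℂ) : rowFactor τ j (u + 1) = rowFactor τ j u := by
  rw [rowFactor, mul_add, mul_one, Complex.cos_add_two_pi, rowFactor]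

/-- The product of the `k`-th powers of the first `n` row factors. -/
def rowProduct (τ : ℂ) (n k : ℕ) (u : ℂ) : ℂ := ∏ j ∈ Finset.range n, rowFactor τ j u ^ k

theorem differentiable_rowProduct (τ : ℂ) (n k : ℕ) : Differentiable ℂ (rowProduct τ n k) := by
  unfold rowProduct
  exact Differentiable.fun_finsetProd fun j _ => (differentiable_rowFactor τ j).pow k

theorem analyticOrderAt_rowProduct_le {τ : ℂ} (hτ : 0 < τ.im) (n k : ℕ) {z : ℂ}
    (hz : rowProduct τ n k z = 0) :
    (∃ a l : ℤ, z = a + l * τ) ∧ analyticOrderAt (rowProduct τ n k) z ≤ k := by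
  obtain ⟨j, hj, hz⟩ := Finset.prod_eq_zero_iff.1 hz
  replace hz : rowFactor τ j z = 0 := by
    by_contra h
    exact pow_ne_zero k h hz
  refine ⟨?_, ?_⟩
  · obtain ⟨a, l, h, -⟩ := exists_eq_add_mul_of_rowFactor_eq_zero hz
    exact ⟨a, l, h⟩
  have hsplit : rowProduct τ n k =
      rowFactor τ j ^ k * fun u => ∏ i ∈ (Finset.range n).erase j, rowFactor τ i u ^ k := by
    funext u
    exact (Finset.mul_prod_erase _ (fun i => rowFactor τ i u ^ k) hj).symm
  have hrest : Differentiable ℂ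
      fun u => ∏ i ∈ (Finset.range n).erase j, rowFactor τ i u ^ k :=
    Differentiable.fun_finsetProd fun i _ => (differentiable_rowFactor τ i).pow k
  have hrest0 : (∏ i ∈ (Finset.range n).erase j, rowFactor τ i z ^ k) ≠ 0 := by
    refine Finset.prod_ne_zero_iff.2 fun i hi => pow_ne_zero _ fun h => ?_
    have h1 := abs_im_of_rowFactor_eq_zero hτ h
    rw [abs_im_of_rowFactor_eq_zero hτ hz] at h1
    have h2 : (j : ℝ) = i := by simpa using mul_right_cancel₀ hτ.ne' h1
    exact (Finset.mem_erase.1 hi).1 (by exact_mod_cast h2.symm)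
  have hF := (differentiable_rowFactor τ j).analyticAt z
  rw [hsplit, analyticOrderAt_mul (hF.pow k) (hrest.analyticAt z), analyticOrderAt_pow hF,
    analyticOrderAt_rowFactor hτ hz, ((hrest.analyticAt z).analyticOrderAt_eq_zero).2 hrest0]
  simp

theorem rowProduct_add_one (τ : ℂ) (n k : ℕ) (u : ℂ) :
    rowProduct τ n k (u + 1) = rowProduct τ n k u := by
  simp only [rowProduct, rowFactor_add_one]

theorem norm_rowProduct_le {τ : ℂ} (hτ : 0 < τ.im) (n k : ℕ) (u : ℂ) :
    ‖rowProduct τ n k u‖ ≤ (((1 + Real.exp (2 * Real.pi * |u.im|)) *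
      Real.exp (2 * Real.pi * (n * τ.im))) ^ k) ^ n := by
  rw [rowProduct, norm_prod]
  calc ∏ j ∈ Finset.range n, ‖rowFactor τ j u ^ k‖
      ≤ ∏ _j ∈ Finset.range n, ((1 + Real.exp (2 * Real.pi * |u.im|)) *
          Real.exp (2 * Real.pi * (n * τ.im))) ^ k := by
        refine Finset.prod_le_prod (fun _ _ => by positivity) fun j hj => ?_
        rw [norm_pow]
        have := norm_rowFactor_le hτ (Finset.mem_range.1 hj) u
        gcongr
    _ = _ := by simp

theorem le_norm_rowProduct {τ : ℂ} (hτ : 0 < τ.im) {n : ℕ} (k : ℕ) {u : ℂ}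
    (hu : |u.im| = 2 * n * τ.im) (hn : 5 ≤ Real.exp (2 * Real.pi * (n * τ.im))) :
    ((Real.exp (2 * Real.pi * (n * τ.im)) ^ 2 / 4) ^ k) ^ n ≤ ‖rowProduct τ n k u‖ := by
  rw [rowProduct, norm_prod]
  calc ((Real.exp (2 * Real.pi * (n * τ.im)) ^ 2 / 4) ^ k) ^ n
      = ∏ _j ∈ Finset.range n, (Real.exp (2 * Real.pi * (n * τ.im)) ^ 2 / 4) ^ k := by simp
    _ ≤ _ := by
      refine Finset.prod_le_prod (fun _ _ => by positivity) fun j hj => ?_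
      rw [norm_pow]
      have := le_norm_rowFactor hτ (Finset.mem_range.1 hj) hu hn
      gcongr

theorem norm_le_of_quasiperiodic {g : ℂ → ℂ} {τ c : ℂ} {K : ℤ} {C₀ : ℝ}
    (h : ∀ u, g (u + τ) = eC (c - K * u - K * τ / 2) * g u)
    (hC₀ : ∀ z : ℂ, z.im = 0 → ‖g z‖ ≤ C₀) {n : ℕ} {u : ℂ} (hu : |u.im| = 2 * n * τ.im) :
    ‖g u‖ ≤ C₀ * (Real.exp (4 * Real.pi * |c.im|) *
      Real.exp (4 * Real.pi * (K * (n * τ.im)))) ^ n := by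
  obtain ⟨N, hN, hNu⟩ : ∃ N : ℤ, |N| = 2 * n ∧ u.im = N * τ.im := by
    rcases abs_eq_abs.1 (hu.trans (abs_of_nonneg (hu ▸ abs_nonneg _)).symm) with h | h
    · exact ⟨2 * n, abs_of_nonneg (by positivity), by rw [h]; push_cast; ring⟩
    · exact ⟨-(2 * n), by rw [abs_neg]; exact abs_of_nonneg (by positivity),
        by rw [h]; push_cast; ring⟩
  have him : (u - N * τ).im = 0 := by simp [hNu]
  have e : g u = g (u - N * τ + N * τ) := by rw [sub_add_cancel]
  have hNr : |(N : ℝ)| = 2 * n := by exact_mod_cast congrArg (Int.cast : ℤ → ℝ) hN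
  have hN2 : (N : ℝ) ^ 2 = 4 * n ^ 2 := by rw [← sq_abs, hNr]; ring
  rw [e, quasiperiodic_int_mul h, norm_mul, mul_comm, norm_eC]
  refine mul_le_mul (hC₀ _ him) ?_ (Real.exp_pos _).le ((norm_nonneg _).trans (hC₀ _ him))
  rw [← Real.exp_add, ← Real.exp_nat_mul, Real.exp_le_exp]
  have i1 : (N * c - N * K * (u - N * τ) - K * τ * N ^ 2 / 2).im =
      N * c.im - K * τ.im * N ^ 2 / 2 := by
    have j1 : (N * K * (u - N * τ) : ℂ) = ((N * K : ℝ) : ℂ) * (u - N * τ) := by push_cast; ring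
    have j2 : (K * τ * N ^ 2 / 2 : ℂ) = ((K * N ^ 2 / 2 : ℝ) : ℂ) * τ := by push_cast; ring
    rw [j1, j2, sub_im, sub_im, im_ofReal_mul, im_ofReal_mul, him]
    simp
    ring
  rw [i1, hN2]
  have h3 : -(N * c.im) ≤ 2 * n * |c.im| := by
    rw [← hNr, ← abs_mul]
    exact neg_le_abs _
  nlinarith [Real.pi_pos]

/-- A quasiperiodic entire function of index `K` vanishing at the origin to an order greater than
`2 K` is identically zero. -/
theorem eq_zero_of_quasiperiodic_of_lt_order {g : ℂ → ℂ} (hg : Differentiable ℂ g) {τ c : ℂ}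
    (hτ : 0 < τ.im) {K : ℤ} (h1 : ∀ u, g (u + 1) = g u)
    (h2 : ∀ u, g (u + τ) = eC (c - K * u - K * τ / 2) * g u) {k : ℕ} (hk : 2 * K < k)
    (hord : (k : ℕ∞) ≤ analyticOrderAt g 0) (z : ℂ) : g z = 0 := by
  have hper : Function.Periodic g 1 := h1
  have hlat : ∀ a l : ℤ, (k : ℕ∞) ≤ analyticOrderAt g (a + l * τ) := by
    intro a l
    rw [analyticOrderAt_add_eq_of_quasiperiodic hg
      (E := fun u => eC (l * c - l * K * u - K * τ * l ^ 2 / 2))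
      (differentiable_eC.comp (by fun_prop)) (fun _ => eC_ne_zero _)
      (quasiperiodic_int_mul h2 l)]
    have := analyticOrderAt_add_eq_of_quasiperiodic hg (E := fun _ => 1) (a := a)
      (by fun_prop) (by simp) (fun u => by simpa using hper.int_mul a u) 0
    rw [zero_add] at this
    rwa [this]
  obtain ⟨C₀, hC₀, hb⟩ := exists_bound_strip_of_periodic hg.continuous h1 0 0
  set A := Real.exp (4 * Real.pi * |c.im|) with hA
  set C₁ := 1 + Real.exp (2 * Real.pi * |z.im|) with hC₁
  have hC₁0 : 0 < C₁ := by positivity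
  have hV : 0 < 2 * Real.pi * τ.im := by have := Real.pi_pos; positivity
  have key : ∀ n : ℕ, 1 ≤ n → |z.im| ≤ 2 * n * τ.im → 5 ≤ Real.exp (2 * Real.pi * (n * τ.im)) →
      ‖g z‖ ≤ C₀ * (A * (4 * C₁) ^ k * Real.exp (-(2 * Real.pi * τ.im) * n)) ^ n := by
    intro n hn1 hzn hn5
    set X := Real.exp (2 * Real.pi * (n * τ.im)) with hX
    have hX0 : 0 < X := Real.exp_pos _
    have hlow := fun (u : ℂ) (hu : |u.im| = 2 * n * τ.im) => le_norm_rowProduct hτ k hu hn5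
    have hpos : 0 < ((X ^ 2 / 4) ^ k) ^ n := by positivity
    have h2n : 0 < 2 * n * τ.im := by
      have : (0 : ℝ) < n := by exact_mod_cast hn1
      positivity
    have hP0 : rowProduct τ n k ≠ 0 := by
      intro h0
      have := hlow ((2 * n * τ.im : ℝ) * I) (by simpa using Or.inl hτ.le)
      rw [h0] at this
      simp only [Pi.zero_apply, norm_zero] at this
      linarith
    obtain ⟨h, hh, hgh⟩ := exists_differentiable_eq_mul (differentiable_rowProduct τ n k) hg hP0
      (fun w => by
        by_cases hw : rowProduct τ n k w = 0
        · obtain ⟨⟨a, l, rfl⟩, hle⟩ := analyticOrderAt_rowProduct_le hτ n k hw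
          exact hle.trans (hlat a l)
        · rw [(((differentiable_rowProduct τ n k).analyticAt w).analyticOrderAt_eq_zero).2 hw]
          exact zero_le)
    have hhper : ∀ u, h (u + 1) = h u := by
      have hprod : ∀ u ∈ Set.univ, rowProduct τ n k u * (h (u + 1) - h u) = 0 := by
        intro u _
        rw [mul_sub, ← hgh, ← rowProduct_add_one, ← hgh, h1, sub_self]
      rcases AnalyticOnNhd.eq_zero_or_eq_zero_of_mul_eq_zero
        (fun w _ => (differentiable_rowProduct τ n k).analyticAt w)
        (fun w _ => (show Differentiable ℂ fun u => h (u + 1) - h u by fun_prop).analyticAt w)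
        hprod isPreconnected_univ with h0 | h0
      · exact absurd (funext fun u => h0 u trivial) hP0
      · exact fun u => sub_eq_zero.1 (h0 u trivial)
    set Bd := C₀ * (A * Real.exp (4 * Real.pi * (K * (n * τ.im)))) ^ n / ((X ^ 2 / 4) ^ k) ^ n
      with hBd
    have hbd : ∀ u : ℂ, |u.im| = 2 * n * τ.im → ‖h u‖ ≤ Bd := by
      intro u hu
      rw [hBd, le_div_iff₀ hpos]
      have e1 := norm_le_of_quasiperiodic h2 (fun w hw => hb w hw.ge hw.le) hu
      rw [hgh, norm_mul] at e1
      exact le_trans (by rw [mul_comm]; gcongr; exact hlow u hu) e1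
    have hhz : ‖h z‖ ≤ Bd := by
      refine norm_le_of_periodic_of_im_eq hh hhper (a := -(2 * n * τ.im)) (b := 2 * n * τ.im)
        (by linarith) (fun w hw => hbd w ?_) (fun w hw => hbd w ?_)
        (abs_le.1 hzn).1 (abs_le.1 hzn).2
      · rw [hw, abs_neg, abs_of_pos h2n]
      · rw [hw, abs_of_pos h2n]
    have hup := norm_rowProduct_le hτ n k z
    rw [← hX, ← hC₁] at hup
    have hexp : Real.exp (4 * Real.pi * (K * (n * τ.im))) ≤
        X ^ k * Real.exp (-(2 * Real.pi * τ.im) * n) := by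
      rw [hX, ← Real.exp_nat_mul, ← Real.exp_add, Real.exp_le_exp]
      have hk' : (2 * K + 1 : ℝ) ≤ k := by exact_mod_cast hk
      have : 0 ≤ 2 * Real.pi * τ.im * n := by positivity
      nlinarith
    calc ‖g z‖ = ‖rowProduct τ n k z‖ * ‖h z‖ := by rw [hgh, norm_mul]
      _ ≤ ((C₁ * X) ^ k) ^ n * Bd := by gcongr
      _ = C₀ * (A * Real.exp (4 * Real.pi * (K * (n * τ.im))) * (4 * C₁) ^ k / X ^ k) ^ n := by
        have e : (C₁ * X) ^ k / (X ^ 2 / 4) ^ k = (4 * C₁) ^ k / X ^ k := by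
          rw [← div_pow, ← div_pow]
          congr 1
          field_simp
        rw [hBd, mul_div_assoc (A * _), ← e]
        simp only [mul_pow, div_pow]
        ring
      _ ≤ C₀ * (A * (4 * C₁) ^ k * Real.exp (-(2 * Real.pi * τ.im) * n)) ^ n := by
        gcongr
        rw [div_le_iff₀ (by positivity)]
        calc A * Real.exp (4 * Real.pi * (K * (n * τ.im))) * (4 * C₁) ^ k
            ≤ A * (X ^ k * Real.exp (-(2 * Real.pi * τ.im) * n)) * (4 * C₁) ^ k := by gcongr
          _ = _ := by ring
  have hnat : Tendsto (fun n : ℕ => (n : ℝ)) atTop atTop := tendsto_natCast_atTop_atTop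
  have t1 : Tendsto (fun n : ℕ => A * (4 * C₁) ^ k * Real.exp (-(2 * Real.pi * τ.im) * n)) atTop
      (𝓝 0) := by
    have := (Real.tendsto_exp_atBot.comp
      (hnat.const_mul_atTop_of_neg (neg_neg_of_pos hV))).const_mul (A * (4 * C₁) ^ k)
    simpa using this
  have t2 : Tendsto (fun n : ℕ => Real.exp (2 * Real.pi * (n * τ.im))) atTop atTop := by
    refine (Real.tendsto_exp_atTop.comp (hnat.const_mul_atTop hV)).congr fun n => ?_
    simp only [Function.comp_apply]
    ring_nf
  have t3 : Tendsto (fun n : ℕ => 2 * n * τ.im) atTop atTop :=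
    (hnat.const_mul_atTop (show 0 < 2 * τ.im by positivity)).congr fun n => by ring
  have t4 : Tendsto (fun n : ℕ => C₀ * (1 / 2 : ℝ) ^ n) atTop (𝓝 0) := by
    simpa using (tendsto_pow_atTop_nhds_zero_of_lt_one (by norm_num : (0 : ℝ) ≤ 1 / 2)
      (by norm_num)).const_mul C₀
  have hle : ‖g z‖ ≤ 0 := by
    refine ge_of_tendsto t4 ?_
    filter_upwards [eventually_ge_atTop 1, t3.eventually_ge_atTop |z.im|,
      t2.eventually_ge_atTop 5, t1.eventually_le_const (show (0 : ℝ) < 1 / 2 by norm_num)]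
      with n e1 e2 e3 e4
    refine (key n e1 e2 e3).trans ?_
    gcongr
  simpa using hle

theorem iteratedDeriv_zero_eq_intervalIntegral {φ : ℂ → ℂ} (hφ : Differentiable ℂ φ) (k : ℕ) :
    iteratedDeriv k φ 0 = (2 * Real.pi * I / k.factorial)⁻¹ *
      ∫ θ in (0 : ℝ)..2 * Real.pi, deriv (circleMap 0 1) θ *
        ((1 / circleMap 0 1 θ ^ (k + 1)) * φ (circleMap 0 1 θ)) := by
  have h := DifferentiableOn.circleIntegral_one_div_sub_center_pow_smul (c := 0) (R := 1)
    one_pos k hφ.differentiableOn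
  have h0 : (2 * Real.pi * I / k.factorial : ℂ) ≠ 0 :=
    div_ne_zero Complex.two_pi_I_ne_zero (by exact_mod_cast k.factorial_ne_zero)
  simp only [circleIntegral, smul_eq_mul, sub_zero] at h
  rw [h, inv_mul_cancel_left₀ h0]

theorem continuous_circleKernel (k : ℕ) : Continuous fun θ : ℝ =>
    deriv (circleMap 0 1) θ * (1 / circleMap 0 1 θ ^ (k + 1)) := by
  have h : ∀ θ : ℝ, circleMap 0 1 θ ^ (k + 1) ≠ 0 := fun θ =>
    pow_ne_zero _ (circleMap_ne_center one_ne_zero)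
  have hc : Continuous (circleMap 0 1) := continuous_circleMap 0 1
  simp only [deriv_circleMap]
  exact (hc.mul continuous_const).mul (continuous_const.div (hc.pow _) h)

theorem continuous_iteratedDeriv_param {X : Type*} [TopologicalSpace X] {F : X → ℂ → ℂ}
    (hF : Continuous (Function.uncurry F)) (hd : ∀ x, Differentiable ℂ (F x)) (k : ℕ) :
    Continuous fun x => iteratedDeriv k (F x) 0 := by
  simp only [fun x => iteratedDeriv_zero_eq_intervalIntegral (hd x) k, ← mul_assoc]
  refine continuous_const.mul
    (intervalIntegral.continuous_parametric_intervalIntegral_of_continuous' ?_ _ _)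
  exact ((continuous_circleKernel k).comp continuous_snd).mul
    (hF.comp (continuous_fst.prodMk ((continuous_circleMap 0 1).comp continuous_snd)))

theorem differentiable_intervalIntegral_param {G : ℝ → ℂ → ℂ}
    (hG : Continuous (Function.uncurry G)) (hd : ∀ θ, Differentiable ℂ (G θ)) (a b : ℝ) :
    Differentiable ℂ fun u => ∫ θ in a..b, G θ u := by
  intro u₀
  have hGc : ∀ u, Continuous fun θ => G θ u := fun u =>
    hG.comp (continuous_id.prodMk continuous_const)
  obtain ⟨M, hM⟩ := ((isCompact_uIcc (a := a) (b := b)).prod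
    (isCompact_closedBall u₀ 2)).exists_bound_of_continuousOn hG.continuousOn
  have hmeas : Measurable fun θ : ℝ => deriv (G θ) u₀ :=
    (measurable_deriv_with_param hG).comp (measurable_id.prodMk measurable_const)
  have hbound : ∀ θ ∈ Set.uIoc a b, ∀ u ∈ Metric.ball u₀ 1, ‖deriv (G θ) u‖ ≤ M := by
    intro θ hθ u hu
    have := Complex.norm_deriv_le_of_forall_mem_sphere_norm_le (c := u) (R := 1) (C := M)
      (f := G θ) one_pos (hd θ).diffContOnCl (fun w hw => by
        refine hM (θ, w) ⟨Set.uIoc_subset_uIcc hθ, ?_⟩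
        rw [mem_sphere_iff_norm] at hw
        rw [mem_ball_iff_norm] at hu
        rw [mem_closedBall_iff_norm]
        calc ‖w - u₀‖ ≤ ‖w - u‖ + ‖u - u₀‖ := norm_sub_le_norm_sub_add_norm_sub _ _ _
          _ ≤ 2 := by linarith)
    simpa using this
  exact (intervalIntegral.hasDerivAt_integral_of_dominated_loc_of_deriv_le
    (F := fun u θ => G θ u) (F' := fun u θ => deriv (G θ) u) (bound := fun _ => M)
    (Metric.ball_mem_nhds u₀ one_pos)
    (Eventually.of_forall fun u => (hGc u).aestronglyMeasurable)
    ((hGc u₀).intervalIntegrable _ _) hmeas.aestronglyMeasurable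
    (Eventually.of_forall hbound) (continuous_const.intervalIntegrable _ _)
    (Eventually.of_forall fun θ _ u _ => (hd θ u).hasDerivAt)).2.differentiableAt

theorem differentiable_iteratedDeriv_param {F : ℂ → ℂ → ℂ}
    (hF : Continuous (Function.uncurry F)) (hd₁ : ∀ t, Differentiable ℂ fun u => F u t)
    (hd₂ : ∀ u, Differentiable ℂ (F u)) (k : ℕ) :
    Differentiable ℂ fun u => iteratedDeriv k (F u) 0 := by
  simp only [fun x => iteratedDeriv_zero_eq_intervalIntegral (hd₂ x) k, ← mul_assoc]
  refine Differentiable.const_mul ?_ _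
  exact differentiable_intervalIntegral_param
    (G := fun θ u => deriv (circleMap 0 1) θ * (1 / circleMap 0 1 θ ^ (k + 1)) *
      F u (circleMap 0 1 θ))
    (((continuous_circleKernel k).comp continuous_fst).mul
      (hF.comp (continuous_snd.prodMk ((continuous_circleMap 0 1).comp continuous_fst))))
    (fun θ => (hd₁ _).const_mul _) _ _

/-- An entire function of polynomial growth of degree `d` with zeros at `0, 1, …, d` vanishes. -/
theorem eq_zero_of_growth_of_zeros {P : ℂ → ℂ} (hP : Differentiable ℂ P) {C : ℝ} {d : ℕ}
    (hC : ∀ u, ‖P u‖ ≤ C * (1 + ‖u‖) ^ d) (h0 : ∀ j : ℕ, j ≤ d → P j = 0) (z : ℂ) : P z = 0 := by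
  have hC0 : 0 ≤ C := by simpa using (norm_nonneg _).trans (hC 0)
  have hder : ∀ n, d < n → iteratedDeriv n P 0 = 0 := by
    intro n hn
    have hlim : Tendsto (fun m : ℕ => (n.factorial * (C * 2 ^ d)) * (m : ℝ)⁻¹) atTop (𝓝 0) := by
      simpa using (tendsto_inv_atTop_nhds_zero_nat (𝕜 := ℝ)).const_mul (n.factorial * (C * 2 ^ d))
    have hle : ‖iteratedDeriv n P 0‖ ≤ 0 := by
      refine ge_of_tendsto hlim ?_
      filter_upwards [eventually_ge_atTop 1] with m hm
      have hm1 : (1 : ℝ) ≤ m := by exact_mod_cast hm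
      have hm0 : (0 : ℝ) < m := by linarith
      have h := Complex.norm_iteratedDeriv_le_of_forall_mem_sphere_norm_le (c := 0) (R := m)
        (C := C * (2 * m) ^ d) n hm0 hP.diffContOnCl (fun w hw => by
          rw [mem_sphere_zero_iff_norm] at hw
          refine (hC w).trans ?_
          rw [hw]
          gcongr
          linarith)
      refine h.trans ?_
      obtain ⟨e, rfl⟩ := Nat.exists_eq_add_of_lt hn
      rw [div_le_iff₀ (by positivity), mul_pow, pow_succ, pow_add]
      have : (1 : ℝ) ≤ m ^ e := one_le_pow₀ hm1
      calc ((d + e + 1).factorial : ℝ) * (C * (2 ^ d * m ^ d))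
          ≤ (d + e + 1).factorial * (C * (2 ^ d * (m ^ d))) * m ^ e :=
            le_mul_of_one_le_right (by positivity) this
        _ = _ := by field_simp
    simpa using hle
  let p : Polynomial ℂ := ∑ n ∈ Finset.range (d + 1),
    Polynomial.monomial n ((n.factorial : ℂ)⁻¹ * iteratedDeriv n P 0)
  have hp : ∀ u, p.eval u = P u := by
    intro u
    rw [← Complex.taylorSeries_eq_of_entire' 0 u hP, tsum_eq_sum (s := Finset.range (d + 1))]
    · simp [p, Polynomial.eval_finsetSum]
    · intro n hn
      rw [hder n (by simpa [Nat.lt_succ_iff] using hn)]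
      simp
  have hdeg : p.natDegree ≤ d := Polynomial.natDegree_sum_le_of_forall_le _ _ fun n hn =>
    (Polynomial.natDegree_monomial_le _).trans (Nat.lt_succ_iff.1 (Finset.mem_range.1 hn))
  have hp0 : p = 0 := by
    refine Polynomial.eq_zero_of_natDegree_lt_card_of_eval_eq_zero p
      (f := fun j : Fin (d + 1) => ((j : ℕ) : ℂ))
      (fun a b hab => Fin.ext (by simpa using hab)) (fun j => ?_) (by simpa using hdeg)
    rw [hp]
    exact h0 j (Nat.lt_succ_iff.1 j.2)
  rw [← hp, hp0, Polynomial.eval_zero]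

theorem norm_le_mul_pow_of_le_order {φ : ℂ → ℂ} (hφ : Differentiable ℂ φ) {C : ℝ} {E : ℕ}
    (hC : ∀ w, ‖w‖ ≤ 1 → ‖φ w‖ ≤ C) (hord : (E : ℕ∞) ≤ analyticOrderAt φ 0) {w : ℂ}
    (hw : ‖w‖ ≤ 1) : ‖φ w‖ ≤ C * ‖w‖ ^ E := by
  have hp : Differentiable ℂ fun u : ℂ => u ^ E := by fun_prop
  obtain ⟨h, hh, hφh⟩ := exists_differentiable_eq_mul hp hφ
    (fun h0 => by simpa using congrFun h0 1) (fun u => by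
      by_cases hu : u ^ E = 0
      · have hu0 : u = 0 := by
          by_contra hne
          exact pow_ne_zero E hne hu
        subst hu0
        refine le_trans ?_ hord
        have : (fun u : ℂ => u ^ E) = id ^ E := rfl
        rw [this, analyticOrderAt_pow analyticAt_id, analyticOrderAt_id]
        simp
      · rw [((hp.analyticAt u).analyticOrderAt_eq_zero).2 hu]
        exact zero_le)
  have hle : ‖h w‖ ≤ C := by
    refine Complex.norm_le_of_forall_mem_frontier_norm_le (U := Metric.ball 0 1)
      Metric.isBounded_ball hh.diffContOnCl (fun u hu => ?_)
      (by rw [closure_ball _ one_ne_zero]; simpa using hw)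
    rw [frontier_ball _ one_ne_zero, mem_sphere_zero_iff_norm] at hu
    have := hC u hu.le
    rwa [hφh, norm_mul, norm_pow, hu, one_pow, one_mul] at this
  rw [hφh, norm_mul, norm_pow, mul_comm]
  gcongr

/-- A continuous function on `ℂ^ι` whose restriction to each complex affine line is entire. -/
structure EntireOnLines {ι : Type*} (f : (ι → ℂ) → ℂ) : Prop where
  continuous : Continuous f
  differentiable_line : ∀ a b, Differentiable ℂ fun u : ℂ => f (a + u • b)

/-- The transformation law of a theta function for the lattice `τℤ^n + ℤ^n`, on generators. -/
structure IsQuasiPeriodic {n : ℕ} (τ : ℂ) (M : Matrix (Fin n) (Fin n) ℤ) (g : (Fin n → ℂ) → ℂ) :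
    Prop where
  add_one : ∀ i z, g (z + Pi.single i 1) = g z
  add_tau : ∀ i z, g (z + Pi.single i τ) =
    eC (-(∑ j, (M i j : ℂ) * z j) - M i i * τ / 2) * g z

theorem iteratedDeriv_mul_of_forall_lt {e φ : ℂ → ℂ} (he : Differentiable ℂ e)
    (hφ : Differentiable ℂ φ) {k : ℕ} {x : ℂ} (h : ∀ i < k, iteratedDeriv i φ x = 0) :
    iteratedDeriv k (fun u => e u * φ u) x = e x * iteratedDeriv k φ x := by
  have := iteratedDeriv_mul (n := k) (x := x) he.contDiff.contDiffAt hφ.contDiff.contDiffAt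
  rw [show (fun u => e u * φ u) = e * φ from rfl, this, Finset.sum_eq_single 0]
  · simp
  · intro i hi h0
    have : i ≤ k := Nat.lt_succ_iff.1 (Finset.mem_range.1 hi)
    rw [h (k - i) (by omega), mul_zero]
  · simp

theorem vecCons_add_smul {n : ℕ} (t u : ℂ) (a b : Fin n → ℂ) :
    vecCons t (a + u • b) = vecCons t a + u • vecCons 0 b := by
  ext i
  refine Fin.cases ?_ (fun j => ?_) i <;> simp

theorem vecCons_add_single_succ {n : ℕ} (t : ℂ) (z : Fin n → ℂ) (i : Fin n) (c : ℂ) :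
    vecCons t (z + Pi.single i c) = vecCons t z + Pi.single i.succ c := by
  ext j
  refine Fin.cases ?_ (fun j => ?_) j
  · simp
  · simp [Pi.single_apply]

theorem vecCons_add_head {n : ℕ} (t : ℂ) (z : Fin n → ℂ) (c : ℂ) :
    vecCons (t + c) z = vecCons t z + Pi.single 0 c := by
  ext j
  refine Fin.cases ?_ (fun j => ?_) j <;> simp

theorem continuous_vecCons {n : ℕ} :
    Continuous fun p : (Fin n → ℂ) × ℂ => (vecCons p.2 p.1 : Fin (n + 1) → ℂ) := by
  refine continuous_pi fun i => ?_
  refine Fin.cases ?_ (fun j => ?_) i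
  · simpa using continuous_snd
  · exact (continuous_apply j).comp continuous_fst

namespace EntireOnLines

variable {n : ℕ} {g : (Fin (n + 1) → ℂ) → ℂ}

theorem differentiable_vecCons (hg : EntireOnLines g) (z : Fin n → ℂ) :
    Differentiable ℂ fun t => g (vecCons t z) := by
  have h := hg.differentiable_line (vecCons 0 z) (Pi.single 0 1)
  have e : ∀ t : ℂ, vecCons 0 z + t • (Pi.single 0 1 : Fin (n + 1) → ℂ) = vecCons t z := by
    intro t
    ext i
    refine Fin.cases ?_ (fun j => ?_) i <;> simp
  simpa only [e] using h

theorem iteratedDeriv_vecCons (hg : EntireOnLines g) (k : ℕ) :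
    EntireOnLines fun z : Fin n → ℂ => iteratedDeriv k (fun t => g (vecCons t z)) 0 where
  continuous := continuous_iteratedDeriv_param (F := fun z t => g (vecCons t z))
    (hg.continuous.comp continuous_vecCons) hg.differentiable_vecCons k
  differentiable_line a b := by
    refine differentiable_iteratedDeriv_param (F := fun u t => g (vecCons t (a + u • b))) ?_
      (fun t => ?_) (fun u => hg.differentiable_vecCons _) k
    · refine hg.continuous.comp (continuous_vecCons.comp (Continuous.prodMk ?_ continuous_snd))
      exact continuous_const.add (continuous_fst.smul continuous_const)
    · simp only [vecCons_add_smul]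
      exact hg.differentiable_line _ _

end EntireOnLines

theorem IsQuasiPeriodic.iteratedDeriv_vecCons {n : ℕ} {τ : ℂ}
    {M : Matrix (Fin (n + 1)) (Fin (n + 1)) ℤ} {g : (Fin (n + 1) → ℂ) → ℂ}
    (hq : IsQuasiPeriodic τ M g) (hg : EntireOnLines g) {k : ℕ}
    (hk : ∀ i < k, ∀ z, iteratedDeriv i (fun t => g (vecCons t z)) 0 = 0) :
    IsQuasiPeriodic τ (M.submatrix Fin.succ Fin.succ)
      fun z : Fin n → ℂ => iteratedDeriv k (fun t => g (vecCons t z)) 0 where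
  add_one i z := by simp only [vecCons_add_single_succ, hq.add_one]
  add_tau i z := by
    simp only [vecCons_add_single_succ, hq.add_tau]
    rw [iteratedDeriv_mul_of_forall_lt _ (hg.differentiable_vecCons z) fun i hi => hk i hi z]
    · simp [Fin.sum_univ_succ]
    · refine differentiable_eC.comp ?_
      simp only [Fin.sum_univ_succ, cons_val_zero, cons_val_succ]
      fun_prop

/-- A theta function vanishing to sufficiently high order at the origin vanishes identically. -/
theorem IsQuasiPeriodic.eq_zero_of_norm_le {τ : ℂ} (hτ : 0 < τ.im) :
    ∀ {n : ℕ} {M : Matrix (Fin n) (Fin n) ℤ} {g : (Fin n → ℂ) → ℂ}, EntireOnLines g →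
      IsQuasiPeriodic τ M g → ∀ {C : ℝ}, (∀ r : ℝ, 0 < r → r ≤ 1 → ∀ z, ‖z‖ ≤ r →
        ‖g z‖ ≤ C * r ^ (1 + ∑ i, 2 * (M i i).toNat)) → ∀ z, g z = 0
  | 0, M, g, _, _, C, hC, z => by
    have hlim : Tendsto (fun m : ℕ => C * (1 / ((m : ℝ) + 1))) atTop (𝓝 0) := by
      simpa using (tendsto_one_div_add_atTop_nhds_zero_nat (𝕜 := ℝ)).const_mul C
    have hle : ‖g z‖ ≤ 0 := ge_of_tendsto' hlim fun m => by
      have h := hC (1 / ((m : ℝ) + 1)) (by positivity)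
        (by rw [div_le_one (by positivity)]; linarith [m.cast_nonneg (α := ℝ)]) z
        (by rw [Subsingleton.elim z 0, norm_zero]; positivity)
      simpa using h
    simpa using hle
  | n + 1, M, g, hg, hq, C, hC, z => by
    have hC0 : 0 ≤ C := by simpa using (norm_nonneg _).trans (hC 1 one_pos le_rfl 0 (by simp))
    have key : ∀ k, k ≤ 2 * (M 0 0).toNat →
        ∀ z, iteratedDeriv k (fun t => g (vecCons t z)) 0 = 0 := by
      intro k
      induction k using Nat.strong_induction_on with
      | _ k ih =>
        intro hk
        refine IsQuasiPeriodic.eq_zero_of_norm_le hτ (hg.iteratedDeriv_vecCons k)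
          (hq.iteratedDeriv_vecCons hg fun i hi => ih i hi (by omega))
          (C := k.factorial * C) fun r hr hr1 z hz => ?_
        have h := Complex.norm_iteratedDeriv_le_of_forall_mem_sphere_norm_le (c := 0) (R := r)
          (C := C * r ^ (1 + ∑ i, 2 * (M i i).toNat)) k hr
          (hg.differentiable_vecCons z).diffContOnCl (fun w hw => by
            refine hC r hr hr1 _ ((pi_norm_le_iff_of_nonneg hr.le).2 fun i => ?_)
            rw [mem_sphere_zero_iff_norm] at hw
            refine Fin.cases ?_ (fun j => ?_) i
            · simpa using hw.le
            · simpa using (norm_le_pi_norm z j).trans hz)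
        refine h.trans ?_
        rw [div_le_iff₀ (by positivity), mul_assoc, mul_assoc, ← pow_add]
        refine mul_le_mul_of_nonneg_left (mul_le_mul_of_nonneg_left
          (pow_le_pow_of_le_one hr.le hr1 ?_) hC0) (by positivity)
        rw [Fin.sum_univ_succ]
        simp only [submatrix_apply]
        omega
    have hz : z = vecCons (z 0) (Fin.tail z) := (Fin.cons_self_tail z).symm
    rw [hz]
    refine eq_zero_of_quasiperiodic_of_lt_order (g := fun t => g (vecCons t (Fin.tail z)))
      (hg.differentiable_vecCons _) (K := M 0 0) (k := 2 * (M 0 0).toNat + 1) hτ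
      (c := -∑ j : Fin n, (M 0 j.succ : ℂ) * z j.succ) (fun u => ?_) (fun u => ?_) (by omega)
      ?_ _
    · simp only [vecCons_add_head, hq.add_one]
    · simp only [vecCons_add_head, hq.add_tau, Fin.sum_univ_succ, cons_val_zero, cons_val_succ,
        Fin.tail]
      congr 2
      ring
    · exact (natCast_le_analyticOrderAt_iff_iteratedDeriv_eq_zero
        ((hg.differentiable_vecCons _).analyticAt 0)).2 fun i hi => key i (by omega) _

/-- Functions with polynomial growth of degree `d` on lines are determined by a grid. -/
theorem eq_zero_of_growth_of_zeros_grid {ι : Type*} [Fintype ι] [DecidableEq ι]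
    {q : (ι → ℂ) → ℂ} {d : ℕ} (hq : ∀ a b, Differentiable ℂ fun u : ℂ => q (a + u • b))
    (hgrow : ∀ a b, ∃ C : ℝ, ∀ u : ℂ, ‖q (a + u • b)‖ ≤ C * (1 + ‖u‖) ^ d)
    (h0 : ∀ s : ι → ℕ, (∀ i, s i ≤ d) → q (fun i => (s i : ℂ)) = 0) (z : ι → ℂ) : q z = 0 := by
  suffices H : ∀ (T : Finset ι) (z : ι → ℂ), (∀ i ∉ T, ∃ j : ℕ, j ≤ d ∧ z i = j) → q z = 0 from
    H Finset.univ z (by simp)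
  intro T
  induction T using Finset.induction_on with
  | empty =>
    intro z hz
    choose s hs hzs using fun i => hz i (Finset.notMem_empty i)
    rw [funext hzs]
    exact h0 s hs
  | insert i T _ ih =>
    intro z hz
    have hupd : ∀ u : ℂ, Function.update z i 0 + u • Pi.single i 1 = Function.update z i u := by
      intro u
      ext j
      by_cases hj : j = i
      · subst hj; simp
      · simp [hj]
    have hd := hq (Function.update z i 0) (Pi.single i 1)
    obtain ⟨C, hC⟩ := hgrow (Function.update z i 0) (Pi.single i 1)
    simp only [hupd] at hd hC
    have h := eq_zero_of_growth_of_zeros hd hC (fun j hj => ih _ fun l hl => ?_) (z i)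
    · simpa using h
    · by_cases hli : l = i
      · subst hli
        exact ⟨j, hj, by simp⟩
      · rw [Function.update_of_ne hli]
        exact hz l (by simp [hli, hl])

theorem Differentiable.entireOnLines {ι : Type*} [Fintype ι] {g : (ι → ℂ) → ℂ}
    (hg : Differentiable ℂ g) : EntireOnLines g where
  continuous := hg.continuous
  differentiable_line a b := hg.comp (by fun_prop)

theorem norm_iteratedDeriv_smul_le {ι : Type*} [Fintype ι] {g : (ι → ℂ) → ℂ}
    (hg : Differentiable ℂ g) {C : ℝ} (hC : ∀ z, ‖z‖ ≤ 1 → ‖g z‖ ≤ C) (d : ℕ) (z : ι → ℂ) :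
    ‖iteratedDeriv d (fun w : ℂ => g (w • z)) 0‖ ≤ d.factorial * C * (1 + ‖z‖) ^ d := by
  have hz : 0 < 1 + ‖z‖ := by positivity
  have h := Complex.norm_iteratedDeriv_le_of_forall_mem_sphere_norm_le (c := 0)
    (R := (1 + ‖z‖)⁻¹) (C := C) (f := fun w : ℂ => g (w • z)) d (by positivity)
    (hg.comp (by fun_prop)).diffContOnCl (fun w hw => by
      rw [mem_sphere_zero_iff_norm] at hw
      refine hC _ ?_
      rw [norm_smul, hw, inv_mul_le_one₀ hz]
      linarith)
  simpa [div_eq_mul_inv] using h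

theorem iteratedDeriv_smul_eq_zero_of_grid {ι : Type*} [Fintype ι] [DecidableEq ι]
    {g : (ι → ℂ) → ℂ} (hg : Differentiable ℂ g) {d : ℕ}
    (h0 : ∀ s : ι → ℕ, (∀ i, s i ≤ d) → ∀ w : ℂ, g (fun i => w * (s i : ℂ)) = 0) (z : ι → ℂ) :
    iteratedDeriv d (fun w : ℂ => g (w • z)) 0 = 0 := by
  obtain ⟨C, hC⟩ := (isCompact_closedBall (0 : ι → ℂ) 1).exists_bound_of_continuousOn
    hg.continuous.continuousOn
  have hC' : ∀ z, ‖z‖ ≤ 1 → ‖g z‖ ≤ C := fun z hz => hC z (by simpa using hz)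
  have hC0 : 0 ≤ C := (norm_nonneg _).trans (hC' 0 (by simp))
  refine eq_zero_of_growth_of_zeros_grid (d := d)
    (q := fun z => iteratedDeriv d (fun w : ℂ => g (w • z)) 0) (fun a b => ?_) (fun a b => ?_)
    (fun s hs => ?_) z
  · refine differentiable_iteratedDeriv_param (F := fun u w => g (w • (a + u • b))) ?_
      (fun t => hg.comp (by fun_prop)) (fun u => hg.comp (by fun_prop)) d
    exact hg.continuous.comp (by fun_prop)
  · refine ⟨d.factorial * C * (1 + ‖a‖ + ‖b‖) ^ d, fun u => ?_⟩
    refine (norm_iteratedDeriv_smul_le hg hC' d _).trans ?_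
    rw [mul_assoc (_ * C), ← mul_pow]
    gcongr
    have h1 : ‖a + u • b‖ ≤ ‖a‖ + ‖u‖ * ‖b‖ := by
      simpa [norm_smul] using norm_add_le a (u • b)
    nlinarith [norm_nonneg a, norm_nonneg b, norm_nonneg u,
      mul_nonneg (norm_nonneg a) (norm_nonneg u)]
  · have : (fun w : ℂ => g (w • fun i => (s i : ℂ))) = fun _ => 0 := by
      ext w
      exact h0 s hs w
    simp [this]

/-- A theta function vanishing on the lines through the points of a large grid vanishes. -/
theorem IsQuasiPeriodic.eq_zero_of_grid {τ : ℂ} (hτ : 0 < τ.im) {n : ℕ}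
    {M : Matrix (Fin n) (Fin n) ℤ} {g : (Fin n → ℂ) → ℂ} (hq : IsQuasiPeriodic τ M g)
    (hg : Differentiable ℂ g)
    (h0 : ∀ s : Fin n → ℕ, (∀ i, s i ≤ ∑ i, 2 * (M i i).toNat) →
      ∀ w : ℂ, g (fun i => w * (s i : ℂ)) = 0) (z : Fin n → ℂ) : g z = 0 := by
  obtain ⟨C, hC⟩ := (isCompact_closedBall (0 : Fin n → ℂ) 1).exists_bound_of_continuousOn
    hg.continuous.continuousOn
  refine hq.eq_zero_of_norm_le hτ hg.entireOnLines (C := C) (fun r hr hr1 z hz => ?_) z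
  have hr0 : (r : ℂ) ≠ 0 := by exact_mod_cast hr.ne'
  have hnr : ‖(r : ℂ)‖ = r := by simp [hr.le]
  have hzr : ‖(r : ℂ)⁻¹ • z‖ ≤ 1 := by
    rw [norm_smul, norm_inv, hnr, inv_mul_le_one₀ hr]
    exact hz
  have hφ : Differentiable ℂ fun w : ℂ => g (w • (r : ℂ)⁻¹ • z) := hg.comp (by fun_prop)
  have h := norm_le_mul_pow_of_le_order hφ (C := C) (E := 1 + ∑ i, 2 * (M i i).toNat)
    (w := (r : ℂ)) (fun w hw => hC _ ?_) ?_ (by rwa [hnr])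
  · simpa only [smul_inv_smul₀ hr0, hnr] using h
  · rw [mem_closedBall_zero_iff, norm_smul]
    exact mul_le_one₀ hw (norm_nonneg _) hzr
  · refine (natCast_le_analyticOrderAt_iff_iteratedDeriv_eq_zero (hφ.analyticAt 0)).2
      fun i hi => ?_
    exact iteratedDeriv_smul_eq_zero_of_grid hg
      (fun s hs => h0 s fun j => (hs j).trans (by omega)) _

/-- Let `L` be a positive definite Jacobi index of rank `N ≥ 2` and let
`Λ ⊆ ℤ^N` be a finite index subgroup.  There is a finite set `S ⊂ ℤ^N`, depending only on
`L` and `Λ`, such that any holomorphic `f : ℂ^N → ℂ` satisfying the elliptic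
transformation law with respect to `L`, `τ` for all `λ, μ ∈ Λ` and whose restrictions
`w ↦ f(w·s)` vanish identically for all `s ∈ S` vanishes identically. -/
theorem elliptic_sublattice_vanishing_by_restrictions
    (N : ℕ) (hN : 2 ≤ N) (L : Matrix (Fin N) (Fin N) ℤ)
    (hSym : L.IsSymm) (hEven : ∀ i, Even (L i i))
    (hPos : (L.map (Int.cast : ℤ → ℝ)).PosDef)
    (Λ : Submodule ℤ (Fin N → ℤ)) (hΛ : Finite ((Fin N → ℤ) ⧸ Λ)) :
    ∃ S : Finset (Fin N → ℤ),
      ∀ τ : UpperHalfPlane, ∀ f : (Fin N → ℂ) → ℂ,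
        Differentiable ℂ f →
        (∀ lam ∈ Λ, ∀ mu ∈ Λ, ∀ z : Fin N → ℂ,
          f (fun i => z i + (lam i : ℂ) * (τ : ℂ) + (mu i : ℂ)) =
            eC (-((τ : ℂ) * (zc lam ⬝ᵥ (L.map (Int.cast : ℤ → ℂ)).mulVec (zc lam)) / 2)
                - zc lam ⬝ᵥ (L.map (Int.cast : ℤ → ℂ)).mulVec z) * f z) →
        (∀ s ∈ S, ∀ w : ℂ, f (fun i => w * (s i : ℂ)) = 0) →
        ∀ z : Fin N → ℂ, f z = 0 := by
  classical
  set m : ℕ := Nat.card ((Fin N → ℤ) ⧸ Λ) with hm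
  have hm0 : (m : ℂ) ≠ 0 := by exact_mod_cast Nat.card_pos.ne'
  have hmem : ∀ i, (Pi.single i (m : ℤ) : Fin N → ℤ) ∈ Λ := by
    intro i
    have h : m • (Submodule.Quotient.mk (p := Λ) (Pi.single i (1 : ℤ))) = 0 := by
      rw [hm]; exact card_nsmul_eq_zero'
    rw [← Submodule.Quotient.mk_smul, Submodule.Quotient.mk_eq_zero] at h
    simpa [← Pi.single_smul] using h
  let M : Matrix (Fin N) (Fin N) ℤ := (m : ℤ) ^ 2 • L
  refine ⟨Fintype.piFinset fun _ => Finset.Icc 0 ((∑ i, 2 * (M i i).toNat : ℕ) : ℤ),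
    fun τ f hf hlaw hS z => ?_⟩
  let g : (Fin N → ℂ) → ℂ := fun z => f ((m : ℂ) • z)
  have hg : Differentiable ℂ g := hf.comp (by fun_prop)
  have hq : IsQuasiPeriodic (τ : ℂ) M g := by
    refine ⟨fun i z => ?_, fun i z => ?_⟩
    · have h := hlaw 0 Λ.zero_mem _ (hmem i) ((m : ℂ) • z)
      have e0 : zc (0 : Fin N → ℤ) = 0 := by ext; simp [zc]
      rw [e0] at h
      simp only [zero_dotProduct, mul_zero, zero_div, neg_zero, sub_zero] at h
      have e1 : eC 0 = 1 := by simp [eC]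
      rw [e1, one_mul] at h
      refine Eq.trans (congrArg f (funext fun j => ?_)) h
      by_cases hj : j = i
      · subst hj; simp [mul_add]
      · simp [hj]
    · have h := hlaw _ (hmem i) 0 Λ.zero_mem ((m : ℂ) • z)
      have e0 : zc (Pi.single i (m : ℤ) : Fin N → ℤ) = Pi.single i (m : ℂ) := by
        ext j
        by_cases hj : j = i
        · subst hj; simp [zc]
        · simp [zc, hj]
      rw [e0] at h
      refine Eq.trans (congrArg f (funext fun j => ?_)) (h.trans (congrArg (eC · * g z) ?_))
      · by_cases hj : j = i
        · subst hj; simp [mul_add]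
        · simp [hj]
      · have hL : ∀ k, ((M i k : ℤ) : ℂ) = m ^ 2 * L i k := fun k => by
          simp [M, -zsmul_eq_mul]
        have hd : (L.map (Int.cast : ℤ → ℂ) *ᵥ Pi.single i (m : ℂ)) i = L i i * m := by
          simp [mulVec]
        rw [single_dotProduct, single_dotProduct, hd]
        simp only [hL, mulVec, dotProduct, Matrix.map_apply, Pi.smul_apply,
          smul_eq_mul, Finset.mul_sum]
        rw [neg_sub_left, neg_sub_left, add_comm]
        congr 2
        · ring
        · exact Finset.sum_congr rfl fun k _ => by ring
  have hz := hq.eq_zero_of_grid τ.im_pos hg (fun s hs w => ?_) ((m : ℂ)⁻¹ • z)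
  · simpa only [g, smul_inv_smul₀ hm0] using hz
  · have h := hS (fun i => s i) (by
      rw [Fintype.mem_piFinset]
      exact fun i => Finset.mem_Icc.2 ⟨by positivity, by exact_mod_cast hs i⟩) (m * w)
    rw [← h]
    refine congrArg f (funext fun j => ?_)
    simp [mul_assoc]
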